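/- arXiv:2504.02629 — 3 statements merged into one kernel-verified Lean document; each statement's English description precedes it below -/
import Mathlib

section
/- Let M ≥ 1 be a natural number, c ≥ 0 a real number, and a, b : Fin M → ℝ with a k ≥ 0 and b k ≥ 0 for all k. Then 2 c · ∑_{k} ∑_{l ≠ k} (a k · b k + a l · b k) ≤ ∑_{k} [ (b k)² + (2 c (M − 1) · a k)² ]. -/
open Finset

theorem sum_sum_erase_fst {ι : Type*} [Fintype ι] [DecidableEq ι] (f : ι → ℝ) :
    ∑ k, ∑ _l ∈ univ.erase k, f k = ((Fintype.card ι : ℝ) - 1) * ∑ k, f k := by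
  simp only [Finset.sum_erase_eq_sub (mem_univ _), sum_const, card_univ, nsmul_eq_mul,
    sum_sub_distrib, ← mul_sum]
  ring

theorem sum_sum_erase_snd {ι : Type*} [Fintype ι] [DecidableEq ι] (f : ι → ℝ) :
    ∑ k, ∑ l ∈ univ.erase k, f l = ((Fintype.card ι : ℝ) - 1) * ∑ k, f k := by
  simp only [Finset.sum_erase_eq_sub (mem_univ _), sum_const, card_univ, nsmul_eq_mul,
    sum_sub_distrib]
  ring

theorem sum_sum_erase_young {ι : Type*} [Fintype ι] [DecidableEq ι] (x b : ι → ℝ) :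
    ∑ k, ∑ l ∈ univ.erase k, (x k * b k + x l * b k)
      ≤ ((Fintype.card ι : ℝ) - 1) * ∑ k, (b k ^ 2 + x k ^ 2) := by
  calc ∑ k, ∑ l ∈ univ.erase k, (x k * b k + x l * b k)
      ≤ ∑ k, ∑ l ∈ univ.erase k, ((b k ^ 2 + x k ^ 2 / 2) + x l ^ 2 / 2) := by
        refine sum_le_sum fun k _ => sum_le_sum fun l _ => ?_
        nlinarith [sq_nonneg (x k - b k), sq_nonneg (x l - b k)]
    _ = ((Fintype.card ι : ℝ) - 1) * ∑ k, (b k ^ 2 + x k ^ 2) := by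
        simp only [sum_add_distrib, sum_sum_erase_fst, ← sum_div,
          sum_sum_erase_snd (fun l => x l ^ 2)]
        ring

/-- Weighted Young-inequality estimate, the combinatorial core of the bound on the
explicit drag forces. -/
theorem drag_young_estimate
    (M : ℕ) (hM : 1 ≤ M) (c : ℝ) (hc : 0 ≤ c)
    (a b : Fin M → ℝ) (ha : ∀ k, 0 ≤ a k) (hb : ∀ k, 0 ≤ b k) :
    2 * c * ∑ k, ∑ l ∈ univ.erase k, (a k * b k + a l * b k)
      ≤ ∑ k, ((b k) ^ 2 + (2 * c * ((M : ℝ) - 1) * a k) ^ 2) := by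
  rcases hM.eq_or_lt with rfl | hM
  · simpa using sq_nonneg (b 0)
  · have hN : 0 < (M : ℝ) - 1 := sub_pos.2 (by exact_mod_cast hM)
    refine le_of_mul_le_mul_left ?_ hN
    have h := sum_sum_erase_young (fun k => 2 * c * ((M : ℝ) - 1) * a k) b
    rw [Fintype.card_fin] at h
    refine le_of_eq_of_le ?_ h
    simp only [mul_sum]
    refine sum_congr rfl fun k _ => sum_congr rfl fun l _ => ?_
    ring
end

section
/- Let d ≥ 1, let φ : EuclideanSpace ℝ (Fin d) × ℝ → ℝ and u : EuclideanSpace ℝ (Fin d) × ℝ → EuclideanSpace ℝ (Fin d) be differentiable at a space-time point (x, t), and define g : ℝ → ℝ by g(s) = (s/(1+|s|))². Then ∂_t (fun (y,s) => g (φ (y,s))) (x,t) + div_x (fun (y,s) => g (φ (y,s)) • u (y,s)) (x,t) = (2 φ(x,t) / (1 + |φ(x,t)|)³) · [ ∂_t φ (x,t) + ⟪u(x,t), ∇_x φ (x,t)⟫ + (div_x u (x,t) / 2) · ( φ(x,t) + |φ(x,t)| · φ(x,t) ) ]. -/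
/-- Partial derivative in the time variable of a space-time field. -/
noncomputable def timeDeriv {d : ℕ} {F : Type*} [NormedAddCommGroup F] [NormedSpace ℝ F]
    (f : EuclideanSpace ℝ (Fin d) × ℝ → F)
    (p : EuclideanSpace ℝ (Fin d) × ℝ) : F :=
  fderiv ℝ f p (0, 1)

/-- Spatial divergence of a space-time vector field. -/
noncomputable def spaceDiv {d : ℕ}
    (v : EuclideanSpace ℝ (Fin d) × ℝ → EuclideanSpace ℝ (Fin d))
    (p : EuclideanSpace ℝ (Fin d) × ℝ) : ℝ :=
  ∑ j, fderiv ℝ v p (EuclideanSpace.single j 1, 0) j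

/-- The map `s ↦ s / (1 + |s|)` is differentiable everywhere, including at the kink of `|s|`. -/
theorem hasDerivAt_div_one_add_abs (s : ℝ) :
    HasDerivAt (fun r : ℝ => r / (1 + |r|)) (1 / (1 + |s|) ^ 2) s := by
  have hpos : (1 + |s|) ≠ 0 := by positivity
  rcases eq_or_ne s 0 with rfl | hs
  · rw [hasDerivAt_iff_tendsto_slope]
    have hcont : ContinuousAt (fun r : ℝ => 1 / (1 + |r|)) 0 :=
      continuousAt_const.div (by fun_prop) hpos
    have hlim := hcont.tendsto.mono_left (nhdsWithin_le_nhds (s := {(0 : ℝ)}ᶜ))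
    simp only [abs_zero, add_zero, one_pow] at hlim ⊢
    refine hlim.congr' ?_
    filter_upwards [self_mem_nhdsWithin] with r hr
    have hr : r ≠ 0 := hr
    have : (1 + |r|) ≠ 0 := by positivity
    simp only [slope_def_field, abs_zero, add_zero, zero_div, sub_zero]
    field_simp
  · have h := (hasDerivAt_id s).div ((hasDerivAt_abs hs).const_add 1) hpos
    refine h.congr_deriv ?_
    simp only [id_eq, self_mul_sign]
    ring

theorem hasDerivAt_div_one_add_abs_sq (s : ℝ) :
    HasDerivAt (fun r : ℝ => (r / (1 + |r|)) ^ 2) (2 * s / (1 + |s|) ^ 3) s := by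
  refine ((hasDerivAt_div_one_add_abs s).pow 2).congr_deriv ?_
  have : (1 + |s|) ≠ 0 := by positivity
  rw [Nat.add_one_sub_one, pow_one]
  push_cast
  field_simp

/-- Product rule for the spatial divergence of a scalar field times a vector field. -/
theorem spaceDiv_smul {d : ℕ} {a : EuclideanSpace ℝ (Fin d) × ℝ → ℝ}
    {u : EuclideanSpace ℝ (Fin d) × ℝ → EuclideanSpace ℝ (Fin d)}
    {p : EuclideanSpace ℝ (Fin d) × ℝ}
    (ha : DifferentiableAt ℝ a p) (hu : DifferentiableAt ℝ u p) :
    spaceDiv (fun q => a q • u q) p = a p * spaceDiv u p + fderiv ℝ a p (u p, 0) := by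
  have hsum : (u p, (0 : ℝ)) = ∑ j, u p j • (EuclideanSpace.single j (1 : ℝ), (0 : ℝ)) := by
    refine Prod.ext ?_ (by simp [Prod.snd_sum])
    simpa [Prod.fst_sum] using ((EuclideanSpace.basisFun (Fin d) ℝ).sum_repr (u p)).symm
  rw [hsum, map_sum]
  simp only [map_smul]
  simp only [spaceDiv, fderiv_fun_smul ha hu, Finset.mul_sum, ← Finset.sum_add_distrib]
  refine Finset.sum_congr rfl fun j _ => ?_
  simp [mul_comm]

/-- With `g(s) = (s/(1+|s|))²`, the bounded variable `α = g(φ)` satisfies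
`∂ₜ(g∘φ) + ∇ₓ·((g∘φ) u)
  = (2φ/(1+|φ|)³) [∂ₜφ + u·∇ₓφ + (∇ₓ·u/2)(φ + |φ|φ)]`, so that solutions of the
modified transport equation yield solutions of the conservative convection
equation. -/
theorem bounded_change_of_variable_transport
    (d : ℕ) (hd : 1 ≤ d)
    (φ : EuclideanSpace ℝ (Fin d) × ℝ → ℝ)
    (u : EuclideanSpace ℝ (Fin d) × ℝ → EuclideanSpace ℝ (Fin d))
    (x : EuclideanSpace ℝ (Fin d)) (t : ℝ)
    (hφ : DifferentiableAt ℝ φ (x, t)) (hu : DifferentiableAt ℝ u (x, t)) :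
    timeDeriv (fun q => (φ q / (1 + |φ q|)) ^ 2) (x, t)
        + spaceDiv (fun q => (φ q / (1 + |φ q|)) ^ 2 • u q) (x, t)
      = (2 * φ (x, t) / (1 + |φ (x, t)|) ^ 3) *
        (timeDeriv φ (x, t) + fderiv ℝ φ (x, t) (u (x, t), 0)
          + (spaceDiv u (x, t) / 2)
            * (φ (x, t) + |φ (x, t)| * φ (x, t))) := by
  have hα := (hasDerivAt_div_one_add_abs_sq (φ (x, t))).comp_hasFDerivAt (x, t) hφ.hasFDerivAt
  have hf : fderiv ℝ (fun q => (φ q / (1 + |φ q|)) ^ 2) (x, t)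
      = (2 * φ (x, t) / (1 + |φ (x, t)|) ^ 3) • fderiv ℝ φ (x, t) := hα.fderiv
  rw [spaceDiv_smul (a := fun q => (φ q / (1 + |φ q|)) ^ 2) hα.differentiableAt hu]
  simp only [timeDeriv, hf, smul_apply, smul_eq_mul]
  have : (1 + |φ (x, t)|) ≠ 0 := by positivity
  field_simp
  ring
end

section
/- Let E be a real normed vector space, t ∈ ℝ, f : ℝ → ℝ and g : ℝ → E be twice continuously differentiable on a neighborhood of t. Then the function τ ↦ f(t+τ) • g(t) + f(t) • g(t) − f(t) • g(t−τ) − f(t+τ) • g(t+τ) is O(τ²) as τ → 0 (IsBigO along the filter 𝓝 0 with respect to τ ↦ τ²). -/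
open Asymptotics

/-- First-order Taylor expansion with remainder `O(h²)` for a function that is `C²` at a point. -/
theorem isBigO_sub_sub_fderiv_of_contDiffAt
    {F E : Type*} [NormedAddCommGroup F] [NormedSpace ℝ F]
    [NormedAddCommGroup E] [NormedSpace ℝ E] {g : F → E} {x : F} (hg : ContDiffAt ℝ 2 g x) :
    (fun h : F => g (x + h) - g x - fderiv ℝ g x h) =O[nhds 0] (fun h : F => ‖h‖ ^ 2) := by
  have hdiff : ∀ᶠ y in nhds x, DifferentiableAt ℝ g y :=
    (hg.eventually (by simp)).mono fun y hy => hy.differentiableAt (by simp)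
  have hderiv : DifferentiableAt ℝ (fderiv ℝ g) x :=
    (hg.fderiv_right (m := 1) (by norm_num)).differentiableAt (by simp)
  obtain ⟨C, hC, hbound⟩ := hderiv.isBigO_sub.exists_pos
  obtain ⟨ε, hε, hball⟩ := Metric.eventually_nhds_iff.1 (hdiff.and hbound.bound)
  refine IsBigO.of_bound C (Metric.eventually_nhds_iff.2 ⟨ε, hε, fun h hh => ?_⟩)
  rw [dist_zero_right] at hh
  have hmem : ∀ y ∈ Metric.closedBall x ‖h‖, dist y x < ε := fun y hy =>
    (Metric.mem_closedBall.1 hy).trans_lt hh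
  have key := (convex_closedBall x ‖h‖).norm_image_sub_le_of_norm_fderiv_le'
    (f := g) (φ := fderiv ℝ g x) (C := C * ‖h‖) (y := x + h)
    (fun y hy => (hball (hmem y hy)).1)
    (fun y hy => (hball (hmem y hy)).2.trans <|
      mul_le_mul_of_nonneg_left (mem_closedBall_iff_norm.1 hy) hC.le)
    (Metric.mem_closedBall_self (norm_nonneg h)) (by simp)
  simpa [pow_two, mul_assoc] using key

/-- The pressure combination `f(t+τ) g(t) + f(t) g(t) - f(t) g(t-τ)` is a
second-order extrapolation of `f(t+τ) g(t+τ)`: their difference is `O(τ²)` as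
`τ → 0`, for `f, g` twice continuously differentiable near `t`. -/
theorem pressure_extrapolation_second_order
    {E : Type*} [NormedAddCommGroup E] [NormedSpace ℝ E]
    (t : ℝ) (f : ℝ → ℝ) (g : ℝ → E) (s : Set ℝ) (hs : s ∈ nhds t)
    (hf : ContDiffOn ℝ 2 f s) (hg : ContDiffOn ℝ 2 g s) :
    (fun τ : ℝ =>
        f (t + τ) • g t + f t • g t - f t • g (t - τ) - f (t + τ) • g (t + τ))
      =O[nhds 0] (fun τ : ℝ => τ ^ 2) := by
  have hR := isBigO_sub_sub_fderiv_of_contDiffAt (hg.contDiffAt hs)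
  have hfd := (hf.contDiffAt hs).differentiableAt (by simp)
  simp only [Real.norm_eq_abs, sq_abs] at hR
  have hadd : Filter.Tendsto (fun τ : ℝ => t + τ) (nhds 0) (nhds t) := by
    simpa using (continuous_const_add t).tendsto 0
  have hneg : Filter.Tendsto (fun τ : ℝ => -τ) (nhds 0) (nhds 0) := by
    simpa using (continuous_neg (G := ℝ)).tendsto 0
  have hRneg := hR.comp_tendsto hneg
  have hbdd : (fun τ : ℝ => f (t + τ)) =O[nhds 0] (fun _ => (1 : ℝ)) :=
    (hfd.continuousAt.tendsto.comp hadd).isBigO_one ℝ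
  have hinc : (fun τ : ℝ => f (t + τ) - f t) =O[nhds 0] (fun τ : ℝ => τ) := by
    simpa [Function.comp_def] using hfd.isBigO_sub.comp_tendsto hadd
  have hpast := (isBigO_const_const (f t) (one_ne_zero (α := ℝ)) (nhds 0)).smul hRneg
  have hfuture := hbdd.smul hR
  have hcross := hinc.smul
    ((fderiv ℝ g t).isBigO_id (nhds 0))
  simp only [Function.comp_def, smul_eq_mul, one_mul, neg_sq, ← pow_two] at hpast hfuture hcross
  refine ((hpast.add hfuture).add hcross).neg_left.congr_left fun τ => ?_
  simp only [map_neg, ← sub_eq_add_neg]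
  module
end
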